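/- Let K be any field and n ≥ 2 an integer, and let W denote the Lie subalgebra [L_K(n)⁻, L_K(n)⁻]. Then [W, W] ≠ {0}; that is, the second derived subalgebra of L_K(n)⁻ is nonzero. -/

import Mathlib

noncomputable section

open scoped BigOperators

attribute [local instance 100] LieRing.ofAssociativeRing

/-- The defining relations of the Cohn algebra `C_K(n)`: `y_i x_j = δ_{ij} 1`.
Generators of the free algebra: `Sum.inl i` is `x_i`, `Sum.inr i` is `y_i`.
Quotienting by this relation is the same as quotienting by the two-sided ideal
generated by the elements `y_i x_j - δ_{ij} 1`. -/
inductive CohnRel (K : Type) [Field K] (n : ℕ) :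
    FreeAlgebra K (Fin n ⊕ Fin n) → FreeAlgebra K (Fin n ⊕ Fin n) → Prop
  | rel (i j : Fin n) : CohnRel K n
      (FreeAlgebra.ι K (Sum.inr i) * FreeAlgebra.ι K (Sum.inl j))
      (if i = j then 1 else 0)

/-- The Cohn algebra `C_K(n)`. -/
abbrev CohnAlgebra (K : Type) [Field K] (n : ℕ) := RingQuot (CohnRel K n)

/-- The generator `x_i` of the Cohn algebra. -/
def cX (K : Type) [Field K] (n : ℕ) (i : Fin n) : CohnAlgebra K n :=
  RingQuot.mkAlgHom K (CohnRel K n) (FreeAlgebra.ι K (Sum.inl i))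

/-- The generator `y_i` of the Cohn algebra. -/
def cY (K : Type) [Field K] (n : ℕ) (i : Fin n) : CohnAlgebra K n :=
  RingQuot.mkAlgHom K (CohnRel K n) (FreeAlgebra.ι K (Sum.inr i))

/-- `x_I` for a word `I` in the alphabet `{1, …, n}` (words are lists, the empty
list being the empty word, with `x_φ = 1`). -/
def xw (K : Type) [Field K] (n : ℕ) (I : List (Fin n)) : CohnAlgebra K n :=
  (I.map (cX K n)).prod

/-- `y_I` for a word `I`. -/
def yw (K : Type) [Field K] (n : ℕ) (I : List (Fin n)) : CohnAlgebra K n :=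
  (I.map (cY K n)).prod

/-- The Leavitt relation `∑ x_i y_i = 1`; quotienting `C_K(n)` by this relation is
the same as quotienting by the two-sided ideal `M` generated by `1 - ∑ x_i y_i`. -/
inductive LeavittRel (K : Type) [Field K] (n : ℕ) :
    CohnAlgebra K n → CohnAlgebra K n → Prop
  | rel : LeavittRel K n (∑ i : Fin n, cX K n i * cY K n i) 1

/-- The Leavitt algebra `L_K(n) = C_K(n)/M`. -/
abbrev LeavittAlgebra (K : Type) [Field K] (n : ℕ) := RingQuot (LeavittRel K n)

/-- The canonical quotient map `C_K(n) → L_K(n)`, `z ↦ z̄`. -/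
def leavittQuot (K : Type) [Field K] (n : ℕ) : CohnAlgebra K n →ₐ[K] LeavittAlgebra K n :=
  RingQuot.mkAlgHom K (LeavittRel K n)

/-- The operator `x_i` on `ℕ → K` attached to a bijection `e : Fin n × ℕ ≃ ℕ`: it places a
sequence on the `i`-th block of indices and is zero elsewhere. -/
def blockInsert (K : Type) [Field K] {n : ℕ} (e : Fin n × ℕ ≃ ℕ) (i : Fin n) :
    Module.End K (ℕ → K) where
  toFun f m := if i = (e.symm m).1 then f (e.symm m).2 else 0
  map_add' f g := by ext m; by_cases h : i = (e.symm m).1 <;> simp [h]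
  map_smul' c f := by ext m; by_cases h : i = (e.symm m).1 <;> simp [h]

/-- The operator `y_i` on `ℕ → K`: it restricts a sequence to the `i`-th block of indices. -/
def blockRestrict (K : Type) [Field K] {n : ℕ} (e : Fin n × ℕ ≃ ℕ) (i : Fin n) :
    Module.End K (ℕ → K) :=
  LinearMap.funLeft K K fun m => e (i, m)

theorem blockRestrict_mul_blockInsert (K : Type) [Field K] {n : ℕ} (e : Fin n × ℕ ≃ ℕ)
    (i j : Fin n) : blockRestrict K e i * blockInsert K e j = if i = j then 1 else 0 := by
  refine LinearMap.ext fun f => funext fun m => ?_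
  by_cases h : i = j
  · simp [h, blockRestrict, blockInsert, LinearMap.funLeft_apply]
  · simp [h, Ne.symm h, blockRestrict, blockInsert, LinearMap.funLeft_apply]

theorem sum_blockInsert_mul_blockRestrict (K : Type) [Field K] {n : ℕ} (e : Fin n × ℕ ≃ ℕ) :
    ∑ i, blockInsert K e i * blockRestrict K e i = 1 := by
  refine LinearMap.ext fun f => funext fun m => ?_
  simp [blockRestrict, blockInsert, LinearMap.funLeft_apply, LinearMap.sum_apply]

/-- The representation of the Cohn algebra on `ℕ → K` by block operators. -/
def cohnRep (K : Type) [Field K] {n : ℕ} (e : Fin n × ℕ ≃ ℕ) :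
    CohnAlgebra K n →ₐ[K] Module.End K (ℕ → K) :=
  RingQuot.liftAlgHom K
    ⟨FreeAlgebra.lift K (Sum.elim (blockInsert K e) (blockRestrict K e)), by
      rintro _ _ ⟨i, j⟩
      rw [map_mul, FreeAlgebra.lift_ι_apply, FreeAlgebra.lift_ι_apply, Sum.elim_inr,
        Sum.elim_inl, blockRestrict_mul_blockInsert]
      split_ifs <;> simp⟩

theorem leavittAlgebra_nontrivial (K : Type) [Field K] (n : ℕ) (hn : 2 ≤ n) :
    Nontrivial (LeavittAlgebra K n) := by
  have : NeZero n := ⟨by omega⟩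
  obtain ⟨e⟩ := nonempty_equiv_of_countable (α := Fin n × ℕ) (β := ℕ)
  let φ : LeavittAlgebra K n →ₐ[K] Module.End K (ℕ → K) :=
    RingQuot.liftAlgHom K ⟨cohnRep K e, by
      rintro _ _ ⟨⟩
      rw [map_one, ← sum_blockInsert_mul_blockRestrict K e, map_sum]
      refine Finset.sum_congr rfl fun i _ => ?_
      simp [cohnRep, cX, cY]⟩
  exact φ.toRingHom.domain_nontrivial

theorem cY_mul_cX (K : Type) [Field K] (n : ℕ) (i j : Fin n) :
    cY K n i * cX K n j = if i = j then 1 else 0 := by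
  have h := RingQuot.mkAlgHom_rel K (CohnRel.rel (K := K) i j)
  rw [map_mul] at h
  rw [cY, cX, h]
  split_ifs <;> simp

/-- If `y₁, y₂` are left dual to `x₁, x₂` in a nontrivial associative algebra, then the second
derived ideal of the associated Lie algebra is nonzero: it contains `x₁ y₁ - x₂ y₂`. -/
theorem derivedSeries_two_ne_bot_of_dual {K A : Type} [Field K] [Ring A] [Algebra K A]
    [Nontrivial A] {x₁ x₂ y₁ y₂ : A} (h₁₁ : y₁ * x₁ = 1) (h₁₂ : y₁ * x₂ = 0)
    (h₂₁ : y₂ * x₁ = 0) (h₂₂ : y₂ * x₂ = 1) : LieAlgebra.derivedSeries K A 2 ≠ ⊥ := by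
  have cancel {a b c : A} (h : b * c = a) (u v : A) : u * b * (c * v) = u * a * v := by
    rw [← h]; simp only [mul_assoc]
  have derived_succ (k : ℕ) {a b : A} (ha : a ∈ LieAlgebra.derivedSeries K A k)
      (hb : b ∈ LieAlgebra.derivedSeries K A k) :
      ⁅a, b⁆ ∈ LieAlgebra.derivedSeries K A (k + 1) := by
    rw [LieAlgebra.derivedSeries_def, LieAlgebra.derivedSeriesOfIdeal_succ]
    exact LieSubmodule.lie_mem_lie ha hb
  have derived_one (a b : A) : ⁅a, b⁆ ∈ LieAlgebra.derivedSeries K A 1 :=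
    derived_succ 0 (by simp) (by simp)
  have e₁₂ : x₁ * y₂ ∈ LieAlgebra.derivedSeries K A 1 := by
    convert derived_one (x₁ * y₁) (x₁ * y₂) using 1
    simp [LieRing.of_associative_ring_bracket, cancel h₁₁, cancel h₂₁]
  have e₂₁ : x₂ * y₁ ∈ LieAlgebra.derivedSeries K A 1 := by
    convert derived_one (x₂ * y₂) (x₂ * y₁) using 1
    simp [LieRing.of_associative_ring_bracket, cancel h₂₂, cancel h₁₂]
  have hmem := derived_succ 1 e₁₂ e₂₁
  rw [LieRing.of_associative_ring_bracket, cancel h₂₂, cancel h₁₁, mul_one, mul_one] at hmem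
  intro hbot
  rw [hbot, LieSubmodule.mem_bot] at hmem
  have h : y₁ * (x₁ * y₁ - x₂ * y₂) * x₁ = 1 := by
    rw [mul_sub, ← mul_assoc, ← mul_assoc, h₁₁, h₁₂, one_mul, zero_mul, sub_zero, h₁₁]
  simp [hmem] at h

/-- Lemma 3.1(iii): with `W = [L_K(n)⁻, L_K(n)⁻]`, one has `[W, W] ≠ {0}`;
i.e. the second derived ideal of `L_K(n)⁻` is nonzero. -/
theorem second_derived_nonzero (K : Type) [Field K] (n : ℕ) (hn : 2 ≤ n) :
    LieAlgebra.derivedSeries K (LeavittAlgebra K n) 2 ≠ ⊥ := by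
  have := leavittAlgebra_nontrivial K n hn
  let i : Fin n := ⟨0, by omega⟩
  let j : Fin n := ⟨1, by omega⟩
  have hij : i ≠ j := by simp [i, j]
  have dual (a b : Fin n) : leavittQuot K n (cY K n a) * leavittQuot K n (cX K n b) =
      if a = b then 1 else 0 := by
    rw [← map_mul, cY_mul_cX]
    split_ifs <;> simp
  exact derivedSeries_two_ne_bot_of_dual (by simpa using dual i i)
    (by simpa [hij] using dual i j) (by simpa [hij.symm] using dual j i)
    (by simpa using dual j j)
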